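/- arXiv:2310.05637 — 6 statements merged into one kernel-verified Lean document; each statement's English description precedes it below -/
import Mathlib

section
/- Let f = Σ_{i,j≥0} c_{ij} x₁^i x₂^j be a nonzero power series with coefficients c_{ij} ∈ ℤ_p, let K be a finite field extension of ℚ_p equipped with the unique valuation v extending the p-adic valuation (normalised by v(p) = 1), and let α₁, α₂ ∈ K with α₁ ≠ 0, α₂ ≠ 0, v(α₁) > 0 and v(α₂) > 0. If f(α₁,α₂) = 0 (the series converging in K), then there exist two distinct pairs (i,j) ≠ (i′,j′) in the support of f such that i·v(α₁) + j·v(α₂) + v(c_{ij}) = i′·v(α₁) + j′·v(α₂) + v(c_{i′j′}) = V_f(v(α₁), v(α₂)). In other words, a zero of f can only occur at a point (v(α₁), v(α₂)) where the minimum defining the Newton copolygon of f is attained at least twice. -/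
noncomputable section

/-- In an ultrametric group, a family summing to zero that is not identically zero attains its
maximal norm at two distinct indices at least. -/
theorem exists_ne_norm_eq_max_of_hasSum_zero {ι E : Type*} [NormedAddCommGroup E]
    [IsUltrametricDist E] {g : ι → E} (hg : HasSum g 0) {i₀ : ι} (hi₀ : g i₀ ≠ 0) :
    ∃ m n, m ≠ n ∧ ‖g m‖ = ‖g n‖ ∧ g m ≠ 0 ∧ ∀ k, ‖g k‖ ≤ ‖g m‖ := by
  classical
  have hpos : 0 < ‖g i₀‖ := norm_pos_iff.mpr hi₀
  have hfin : {k | ‖g i₀‖ ≤ ‖g k‖}.Finite := by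
    have h := hg.summable.tendsto_cofinite_zero.norm
    rw [norm_zero] at h
    have h2 := h.eventually_lt_const hpos
    rw [Filter.eventually_cofinite] at h2
    simpa using h2
  obtain ⟨m, hm, hmax⟩ := Set.exists_max_image _ (fun k => ‖g k‖) hfin ⟨i₀, le_refl ‖g i₀‖⟩
  have hmpos : 0 < ‖g m‖ := hpos.trans_le hm
  have hle : ∀ k, ‖g k‖ ≤ ‖g m‖ := fun k => by
    rcases le_total ‖g i₀‖ ‖g k‖ with h | h
    · exact hmax k h
    · exact h.trans hm
  by_contra hcon
  have hlt : ∀ k, k ≠ m → ‖g k‖ < ‖g m‖ := fun k hk =>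
    (hle k).lt_of_ne fun h => hcon ⟨m, k, hk.symm, h.symm, norm_pos_iff.mp hmpos, hle⟩
  have hsum : ∀ s : Finset ι, m ∈ s → ‖∑ k ∈ s, g k‖ = ‖g m‖ := fun s hs => by
    have hrest : ‖∑ k ∈ s.erase m, g k‖ < ‖g m‖ := by
      rcases (s.erase m).eq_empty_or_nonempty with h | h
      · simpa [h] using hmpos
      · obtain ⟨k, hk, hk'⟩ := IsUltrametricDist.exists_norm_finsetSum_le_of_nonempty h g
        exact hk'.trans_lt (hlt k (Finset.ne_of_mem_erase hk))
    rw [← Finset.add_sum_erase s g hs,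
      IsUltrametricDist.norm_add_eq_max_of_norm_ne_norm hrest.ne', max_eq_left hrest.le]
  have hlim : Filter.Tendsto (fun s : Finset ι => ‖∑ k ∈ s, g k‖) Filter.atTop (nhds ‖g m‖) :=
    tendsto_const_nhds.congr' <| by
      filter_upwards [Filter.eventually_ge_atTop {m}] with s hs
      exact (hsum s (hs (Finset.mem_singleton_self m))).symm
  have h0 := tendsto_nhds_unique hlim (Filter.Tendsto.norm hg)
  rw [norm_zero] at h0
  exact hmpos.ne' h0

/-- Let `f = Σ c_{ij} x₁^i x₂^j` be a nonzero power series with coefficients in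
`ℤ_p`, let `K` be a finite extension of `ℚ_p` with the unique (nonarchimedean) absolute value
extending the `p`-adic one, and let `α₁, α₂ ∈ K` be nonzero with `v(α₁) > 0`, `v(α₂) > 0`.
If `f(α₁,α₂) = 0` (the series converging in `K`), then the minimum defining the Newton copolygon
of `f` at `(v(α₁), v(α₂))` is attained at two distinct pairs of the support: multiplicatively,
there are `(i,j) ≠ (i′,j′)` with `c_{ij} ≠ 0 ≠ c_{i′j′}` such that
`‖c_{ij}‖·‖α₁‖^i·‖α₂‖^j = ‖c_{i′j′}‖·‖α₁‖^{i′}·‖α₂‖^{j′}` equals the supremum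
`sup { ‖c_{kl}‖·‖α₁‖^k·‖α₂‖^l : c_{kl} ≠ 0 } = p^{-V_f(v(α₁),v(α₂))}`. -/
theorem copolygon_zero_exceptional (p : ℕ) [Fact p.Prime] (K : Type)
    [NontriviallyNormedField K] [CompleteSpace K] [IsUltrametricDist K]
    [Algebra ℚ_[p] K] [FiniteDimensional ℚ_[p] K]
    (hnorm : ∀ q : ℚ_[p], ‖algebraMap ℚ_[p] K q‖ = ‖q‖)
    (c : ℕ → ℕ → ℤ_[p]) (hc : ∃ i j, c i j ≠ 0)
    (α₁ α₂ : K) (hα₁0 : α₁ ≠ 0) (hα₂0 : α₂ ≠ 0) (hα₁ : ‖α₁‖ < 1) (hα₂ : ‖α₂‖ < 1)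
    (hzero : HasSum (fun ij : ℕ × ℕ =>
        algebraMap ℚ_[p] K ((c ij.1 ij.2 : ℚ_[p])) * α₁ ^ ij.1 * α₂ ^ ij.2) 0) :
    ∃ i j i' j' : ℕ, (i, j) ≠ (i', j') ∧ c i j ≠ 0 ∧ c i' j' ≠ 0
      ∧ ‖c i j‖ * ‖α₁‖ ^ i * ‖α₂‖ ^ j = ‖c i' j'‖ * ‖α₁‖ ^ i' * ‖α₂‖ ^ j'
      ∧ ‖c i j‖ * ‖α₁‖ ^ i * ‖α₂‖ ^ j
          = sSup {x : ℝ | ∃ k l, c k l ≠ 0 ∧ x = ‖c k l‖ * ‖α₁‖ ^ k * ‖α₂‖ ^ l} := by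
  have hnorm_term (k l : ℕ) :
      ‖algebraMap ℚ_[p] K (c k l : ℚ_[p]) * α₁ ^ k * α₂ ^ l‖ =
        ‖c k l‖ * ‖α₁‖ ^ k * ‖α₂‖ ^ l := by
    rw [norm_mul, norm_mul, norm_pow, norm_pow, hnorm, PadicInt.norm_def]
  have hterm (k l : ℕ) :
      algebraMap ℚ_[p] K (c k l : ℚ_[p]) * α₁ ^ k * α₂ ^ l ≠ 0 ↔ c k l ≠ 0 := by
    simp [hα₁0, hα₂0]
  obtain ⟨a, b, hab⟩ := hc
  obtain ⟨⟨i, j⟩, ⟨i', j'⟩, hne, heq, hij, hmax⟩ :=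
    exists_ne_norm_eq_max_of_hasSum_zero hzero (i₀ := (a, b)) ((hterm a b).mpr hab)
  have hij' := norm_pos_iff.mp (heq ▸ norm_pos_iff.mpr hij)
  simp only [hnorm_term] at heq hmax
  refine ⟨i, j, i', j', hne, (hterm i j).mp hij, (hterm i' j').mp hij', heq, ?_⟩
  symm
  apply IsGreatest.csSup_eq
  refine ⟨⟨i, j, (hterm i j).mp hij, rfl⟩, ?_⟩
  rintro x ⟨k, l, -, rfl⟩
  exact hmax (k, l)
end
end

section
/- Let n ≥ 1 and let (ξ,η) ∈ Ω² be a nontrivial p^n-torsion point of 𝒟 (i.e. 𝒟^{∘n}(ξ,η) = (0,0) and 𝒟^{∘(n−1)}(ξ,η) ≠ (0,0)). Then: if n = 2m is even, v(ξ) = (p^{h₂} + 1)/(p^{hm − h₁}·(p^h − 1)) and v(η) = (p^{h₁} + 1)/(p^{hm − h₂}·(p^h − 1)); and if n = 2m + 1 is odd, v(ξ) = (p^{h₁} + 1)/(p^{hm}·(p^h − 1)) and v(η) = (p^{h₂} + 1)/(p^{hm}·(p^h − 1)). -/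
noncomputable section

/-- The dynamical system `𝒟(x₁,x₂) = (p·x₁ + x₂^{p^{h₁}}, p·x₂ + x₁^{p^{h₂}})`, the simplest
approximation of the multiplication-by-`p` endomorphism of the 2-dimensional Lubin–Tate formal
group attached to `(h₁,h₂)`. -/
def Dmap (p h₁ h₂ : ℕ) (Ω : Type) [Field Ω] : Ω × Ω → Ω × Ω :=
  fun x => ((p : Ω) * x.1 + x.2 ^ (p ^ h₁), (p : Ω) * x.2 + x.1 ^ (p ^ h₂))

/-- If `‖y‖ ≤ ‖x‖` and `1 < ‖x‖`, then `x ^ r` dominates `c * y`. -/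
theorem one_lt_norm_mul_add_pow {K : Type*} [NormedField K] [IsUltrametricDist K]
    {c x y : K} {r : ℕ} (hc : ‖c‖ < 1) (hr : r ≠ 0) (hyx : ‖y‖ ≤ ‖x‖) (hx : 1 < ‖x‖) :
    1 < ‖c * y + x ^ r‖ := by
  have hlt : ‖c * y‖ < ‖x ^ r‖ := by
    rw [norm_mul, norm_pow]
    calc ‖c‖ * ‖y‖ ≤ ‖c‖ * ‖x‖ := by gcongr
      _ < 1 * ‖x‖ := by gcongr
      _ ≤ ‖x‖ ^ r := by rw [one_mul]; exact le_self_pow₀ hx.le hr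
  rw [IsUltrametricDist.norm_add_eq_max_of_norm_ne_norm hlt.ne, max_eq_right hlt.le, norm_pow]
  exact one_lt_pow₀ hx hr

/-- If `(c x + y ^ r, c y + x ^ s) = (u, w)` with `‖u‖` and `‖w‖` strictly between `‖c‖` and `1`,
then the powers dominate: `‖y‖ ^ r = ‖u‖` and `‖x‖ ^ s = ‖w‖`. -/
theorem norm_pow_eq_of_mul_add_pow_eq {K : Type*} [NormedField K] [IsUltrametricDist K]
    {c x y u w : K} {r s : ℕ} (hr : r ≠ 0) (hs : s ≠ 0)
    (hu : c * x + y ^ r = u) (hw : c * y + x ^ s = w)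
    (hcu : ‖c‖ < ‖u‖) (hu1 : ‖u‖ < 1) (hcw : ‖c‖ < ‖w‖) (hw1 : ‖w‖ < 1) :
    ‖y‖ ^ r = ‖u‖ ∧ ‖x‖ ^ s = ‖w‖ := by
  have hc : ‖c‖ < 1 := hcu.trans hu1
  have hxy : ‖x‖ ≤ 1 ∧ ‖y‖ ≤ 1 := by
    rcases le_total ‖x‖ ‖y‖ with hle | hle
    · have hy : ‖y‖ ≤ 1 := by
        by_contra! hy
        have := one_lt_norm_mul_add_pow hc hr hle hy
        rw [hu] at this
        linarith
      exact ⟨hle.trans hy, hy⟩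
    · have hx : ‖x‖ ≤ 1 := by
        by_contra! hx
        have := one_lt_norm_mul_add_pow hc hs hle hx
        rw [hw] at this
        linarith
      exact ⟨hx, hle.trans hx⟩
  have key : ∀ {a b z : K} {t : ℕ}, ‖a‖ ≤ 1 → c * a + b ^ t = z → ‖c‖ < ‖z‖ →
      ‖b‖ ^ t = ‖z‖ := by
    intro a b z t ha hz hcz
    have hlt : ‖-(c * a)‖ < ‖z‖ := by
      rw [norm_neg, norm_mul]
      exact (mul_le_of_le_one_right (norm_nonneg c) ha).trans_lt hcz
    have hb : b ^ t = -(c * a) + z := by rw [← hz]; ring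
    rw [← norm_pow, hb, IsUltrametricDist.norm_add_eq_max_of_norm_ne_norm hlt.ne,
      max_eq_right hlt.le]
  exact ⟨key hxy.1 hu hcu, key hxy.2 hw hcw⟩

/-- The valuations of a point of exact level `k + 1` of `(x, y) ↦ (p x + y ^ r, p y + x ^ s)`. -/
def torsionVal (r s : ℝ) : ℕ → ℝ × ℝ
  | 0 => ((r + 1) / (r * s - 1), (s + 1) / (r * s - 1))
  | k + 1 => ((torsionVal r s k).2 / s, (torsionVal r s k).1 / r)

theorem torsionVal_mem {r s : ℝ} (hr : 3 ≤ r) (hs : 3 ≤ s) (k : ℕ) :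
    ((torsionVal r s k).1 ∈ Set.Ioo (0 : ℝ) 1) ∧ (torsionVal r s k).2 ∈ Set.Ioo (0 : ℝ) 1 := by
  induction k with
  | zero =>
    have h : 0 < r * s - 1 := by nlinarith
    refine ⟨⟨by simp only [torsionVal]; positivity, ?_⟩,
      ⟨by simp only [torsionVal]; positivity, ?_⟩⟩ <;>
    · simp only [torsionVal]
      rw [div_lt_one h]
      nlinarith
  | succ k ih =>
    obtain ⟨⟨h1, h2⟩, h3, h4⟩ := ih
    refine ⟨⟨by simp only [torsionVal]; positivity, ?_⟩,
      ⟨by simp only [torsionVal]; positivity, ?_⟩⟩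
    · simp only [torsionVal]
      rw [div_lt_one (by linarith)]
      linarith
    · simp only [torsionVal]
      rw [div_lt_one (by linarith)]
      linarith

theorem torsionVal_even {r s : ℝ} (m : ℕ) :
    torsionVal r s (2 * m) =
      ((r + 1) / ((r * s) ^ m * (r * s - 1)), (s + 1) / ((r * s) ^ m * (r * s - 1))) := by
  induction m with
  | zero => simp [torsionVal]
  | succ m ih =>
    rw [show 2 * (m + 1) = 2 * m + 1 + 1 by ring]
    simp only [torsionVal, ih, div_div, pow_succ]
    ext <;> dsimp only <;> congr 1 <;> ring

/-- A nonzero solution of `p x + y ^ r = 0 = p y + x ^ s`, in terms of norms. -/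
theorem eq_rpow_torsionVal_zero {p a b : ℝ} (hp : 1 < p) (ha : 0 < a) (hb : 0 < b) {r s : ℕ}
    (hr : 3 ≤ r) (hs : 3 ≤ s) (h1 : b ^ r = p⁻¹ * a) (h2 : a ^ s = p⁻¹ * b) :
    a = p ^ (-(torsionVal r s 0).1) ∧ b = p ^ (-(torsionVal r s 0).2) := by
  have hp0 : 0 < p := by linarith
  have hr' : (3 : ℝ) ≤ r := by exact_mod_cast hr
  have hs' : (3 : ℝ) ≤ s := by exact_mod_cast hs
  have hrs : (r : ℝ) * s - 1 ≠ 0 := by nlinarith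
  have l1 := congrArg Real.log h1
  have l2 := congrArg Real.log h2
  rw [Real.log_pow, Real.log_mul (by positivity) ha.ne', Real.log_inv] at l1
  rw [Real.log_pow, Real.log_mul (by positivity) hb.ne', Real.log_inv] at l2
  constructor
  · apply Real.log_injOn_pos ha (Real.rpow_pos_of_pos hp0 _)
    rw [Real.log_rpow hp0]
    simp only [torsionVal]
    rw [← neg_div, div_mul_eq_mul_div, eq_div_iff hrs]
    linear_combination l1 + (r : ℝ) * l2
  · apply Real.log_injOn_pos hb (Real.rpow_pos_of_pos hp0 _)
    rw [Real.log_rpow hp0]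
    simp only [torsionVal]
    rw [← neg_div, div_mul_eq_mul_div, eq_div_iff hrs]
    linear_combination l2 + (s : ℝ) * l1

theorem eq_rpow_div_of_pow_eq {p a t : ℝ} (hp : 0 < p) (ha : 0 ≤ a) {r : ℕ} (hr : r ≠ 0)
    (h : a ^ r = p ^ (-t)) : a = p ^ (-(t / r)) := by
  rw [← Real.pow_rpow_inv_natCast ha hr, h, ← Real.rpow_mul hp.le]
  congr 1
  ring

theorem norm_eq_rpow_torsionVal {p h₁ h₂ : ℕ} {Ω : Type} [NormedField Ω] [IsUltrametricDist Ω]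
    (hp : 1 < p) (hnorm : ‖(p : Ω)‖ = (p : ℝ)⁻¹) (hr : 3 ≤ p ^ h₁) (hs : 3 ≤ p ^ h₂)
    (k : ℕ) (ξ η : Ω) (htors : (Dmap p h₁ h₂ Ω)^[k + 1] (ξ, η) = (0, 0))
    (hnontriv : (Dmap p h₁ h₂ Ω)^[k] (ξ, η) ≠ (0, 0)) :
    ‖ξ‖ = (p : ℝ) ^ (-(torsionVal (p ^ h₁ : ℕ) (p ^ h₂ : ℕ) k).1) ∧
      ‖η‖ = (p : ℝ) ^ (-(torsionVal (p ^ h₁ : ℕ) (p ^ h₂ : ℕ) k).2) := by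
  have hp1 : (1 : ℝ) < p := by exact_mod_cast hp
  have hp0 : (0 : ℝ) < p := by linarith
  induction k generalizing ξ η with
  | zero =>
    simp only [zero_add, Function.iterate_one, Function.iterate_zero, id_eq, Dmap, Prod.mk.injEq,
      ne_eq, not_and] at htors hnontriv
    obtain ⟨e1, e2⟩ := htors
    have n1 : ‖η‖ ^ p ^ h₁ = (p : ℝ)⁻¹ * ‖ξ‖ := by
      rw [← norm_pow, eq_neg_of_add_eq_zero_right e1, norm_neg, norm_mul, hnorm]
    have n2 : ‖ξ‖ ^ p ^ h₂ = (p : ℝ)⁻¹ * ‖η‖ := by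
      rw [← norm_pow, eq_neg_of_add_eq_zero_right e2, norm_neg, norm_mul, hnorm]
    have hξ : ξ ≠ 0 := by
      intro h
      refine hnontriv h ?_
      rw [h, norm_zero, mul_zero] at n1
      exact norm_eq_zero.mp (eq_zero_of_pow_eq_zero n1)
    have hη : η ≠ 0 := by
      intro h
      rw [h, norm_zero, mul_zero] at n2
      exact hξ (norm_eq_zero.mp (eq_zero_of_pow_eq_zero n2))
    exact eq_rpow_torsionVal_zero hp1 (norm_pos_iff.mpr hξ) (norm_pos_iff.mpr hη) hr hs n1 n2
  | succ k ih =>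
    rw [Function.iterate_succ_apply] at htors hnontriv
    obtain ⟨hu, hw⟩ := ih _ _ htors hnontriv
    have hmem := torsionVal_mem (r := (p ^ h₁ : ℕ)) (s := (p ^ h₂ : ℕ))
      (by exact_mod_cast hr) (by exact_mod_cast hs) k
    obtain ⟨⟨ha0, ha1⟩, hb0, hb1⟩ := hmem
    have lower : ∀ {t : ℝ}, t < 1 → ‖(p : Ω)‖ < (p : ℝ) ^ (-t) := by
      intro t ht
      rw [hnorm, ← Real.rpow_neg_one]
      exact Real.rpow_lt_rpow_of_exponent_lt hp1 (by linarith)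
    have upper : ∀ {t : ℝ}, 0 < t → (p : ℝ) ^ (-t) < 1 := fun ht =>
      Real.rpow_lt_one_of_one_lt_of_neg hp1 (by linarith)
    obtain ⟨hη, hξ⟩ := norm_pow_eq_of_mul_add_pow_eq (r := p ^ h₁) (s := p ^ h₂) (x := ξ) (y := η)
      (by omega) (by omega) rfl rfl (hu ▸ lower ha1) (hu ▸ upper ha0) (hw ▸ lower hb1)
      (hw ▸ upper hb0)
    exact ⟨eq_rpow_div_of_pow_eq hp0 (norm_nonneg _) (by omega) (hξ.trans hw),
      eq_rpow_div_of_pow_eq hp0 (norm_nonneg _) (by omega) (hη.trans hu)⟩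

/-- Valuations of the nontrivial `pⁿ`-torsion points `(ξ,η)` of `𝒟` (`p` odd,
`h₁, h₂ ≥ 2` coprime, `h = h₁ + h₂`); `v` is the valuation on `Ω` with `v(p) = 1`, expressed
multiplicatively: `v(x) = r ↔ ‖x‖ = p^{-r}`. If `n = 2m` then
`v(ξ) = (p^{h₂}+1)/(p^{hm−h₁}(p^h−1))` and `v(η) = (p^{h₁}+1)/(p^{hm−h₂}(p^h−1))`;
if `n = 2m+1` then `v(ξ) = (p^{h₁}+1)/(p^{hm}(p^h−1))` and `v(η) = (p^{h₂}+1)/(p^{hm}(p^h−1))`. -/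
theorem dynSys_torsion_valuations (p : ℕ) [Fact p.Prime] (hodd : Odd p) (h₁ h₂ : ℕ)
    (hh₁ : 2 ≤ h₁) (hh₂ : 2 ≤ h₂) (hcop : Nat.Coprime h₁ h₂)
    (Ω : Type) [NontriviallyNormedField Ω] [Algebra ℚ_[p] Ω] [IsAlgClosure ℚ_[p] Ω]
    [IsUltrametricDist Ω]
    (hnorm : ∀ q : ℚ_[p], ‖algebraMap ℚ_[p] Ω q‖ = ‖q‖)
    (n : ℕ) (hn : 1 ≤ n) (ξ η : Ω)
    (htors : (Dmap p h₁ h₂ Ω)^[n] (ξ, η) = (0, 0))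
    (hnontriv : (Dmap p h₁ h₂ Ω)^[n - 1] (ξ, η) ≠ (0, 0)) :
    (∀ m : ℕ, n = 2 * m →
      ‖ξ‖ = (p : ℝ) ^ (-(((p : ℝ) ^ h₂ + 1)
          / ((p : ℝ) ^ (((h₁ + h₂ : ℕ) * m : ℤ) - (h₁ : ℤ)) * ((p : ℝ) ^ (h₁ + h₂) - 1))))
      ∧ ‖η‖ = (p : ℝ) ^ (-(((p : ℝ) ^ h₁ + 1)
          / ((p : ℝ) ^ (((h₁ + h₂ : ℕ) * m : ℤ) - (h₂ : ℤ)) * ((p : ℝ) ^ (h₁ + h₂) - 1)))))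
    ∧ (∀ m : ℕ, n = 2 * m + 1 →
      ‖ξ‖ = (p : ℝ) ^ (-(((p : ℝ) ^ h₁ + 1)
          / ((p : ℝ) ^ (((h₁ + h₂ : ℕ) * m : ℤ)) * ((p : ℝ) ^ (h₁ + h₂) - 1))))
      ∧ ‖η‖ = (p : ℝ) ^ (-(((p : ℝ) ^ h₂ + 1)
          / ((p : ℝ) ^ (((h₁ + h₂ : ℕ) * m : ℤ)) * ((p : ℝ) ^ (h₁ + h₂) - 1))))) := by
  have hp2 : 2 ≤ p := (Fact.out : p.Prime).two_le
  have hp0 : (p : ℝ) ≠ 0 := by positivity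
  have hnormp : ‖(p : Ω)‖ = (p : ℝ)⁻¹ := by
    rw [← map_natCast (algebraMap ℚ_[p] Ω) p, hnorm, Padic.norm_p]
  have three_le : ∀ {e : ℕ}, 2 ≤ e → 3 ≤ p ^ e := fun {e} he =>
    calc 3 ≤ 2 ^ 2 := by norm_num
      _ ≤ p ^ 2 := Nat.pow_le_pow_left hp2 2
      _ ≤ p ^ e := Nat.pow_le_pow_right (by omega) he
  have key := norm_eq_rpow_torsionVal (by omega) hnormp (three_le hh₁) (three_le hh₂) (n - 1) ξ η
    (by rwa [Nat.sub_add_cancel hn]) hnontriv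
  have hmul : (p : ℝ) ^ h₁ * (p : ℝ) ^ h₂ = (p : ℝ) ^ (h₁ + h₂) := (pow_add _ _ _).symm
  have hzpow : ∀ m : ℕ, (p : ℝ) ^ (((h₁ + h₂ : ℕ) * m : ℤ)) = ((p : ℝ) ^ (h₁ + h₂)) ^ m := by
    intro m
    rw [← pow_mul, ← zpow_natCast, Nat.cast_mul]
  refine ⟨fun m hm => ?_, fun m hm => ?_⟩
  · obtain ⟨m, rfl⟩ : ∃ l, m = l + 1 := ⟨m - 1, by omega⟩
    rw [show n - 1 = 2 * m + 1 by omega] at key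
    simp only [torsionVal, torsionVal_even, Nat.cast_pow, hmul, div_div] at key
    rw [zpow_sub₀ hp0, zpow_sub₀ hp0, hzpow, zpow_natCast, zpow_natCast]
    convert key using 5
    · rw [pow_succ, ← hmul]
      field_simp
    · rw [pow_succ, ← hmul]
      field_simp
  · rw [show n - 1 = 2 * m by omega] at key
    simp only [torsionVal_even, Nat.cast_pow, hmul] at key
    rwa [hzpow]
end
end

section
/- A pair (ξ,η) ∈ Ω² with (ξ,η) ≠ (0,0) satisfies 𝒟(ξ,η) = (0,0) if and only if η^{p^h − 1} = p^{p^{h₂} + 1} and ξ = −p^{−1}·η^{p^{h₁}}. Consequently there are exactly p^h − 1 nontrivial p-torsion points of 𝒟, one for each of the p^h − 1 roots η in Ω of the equation T^{p^h − 1} = p^{p^{h₂} + 1}. -/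
noncomputable section

/-- Over an algebraically closed field of characteristic zero, a nonzero element has exactly `n`
distinct `n`-th roots. -/
theorem card_nthRootsFinset_of_isAlgClosed {K : Type*} [Field K] [IsAlgClosed K] [CharZero K]
    {n : ℕ} (hn : n ≠ 0) {a : K} (ha : a ≠ 0) :
    (Polynomial.nthRootsFinset n a).card = n := by
  classical
  have hsep : (Polynomial.X ^ n - Polynomial.C a).Separable :=
    Polynomial.separable_X_pow_sub_C a (Nat.cast_ne_zero.mpr hn) ha
  rw [Polynomial.nthRootsFinset_def, Polynomial.nthRoots, Multiset.toFinset_card_of_nodup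
    (Polynomial.nodup_roots hsep),
    ← (IsAlgClosed.splits (Polynomial.X ^ n - Polynomial.C a)).natDegree_eq_card_roots,
    Polynomial.natDegree_X_pow_sub_C]

theorem Dmap_eq_zero_iff {p : ℕ} (hodd : Odd p) (h₁ h₂ : ℕ) {K : Type} [Field K]
    (hp : (p : K) ≠ 0) {ξ η : K} (hne : (ξ, η) ≠ (0, 0)) :
    Dmap p h₁ h₂ K (ξ, η) = (0, 0) ↔
      η ^ (p ^ (h₁ + h₂) - 1) = (p : K) ^ (p ^ h₂ + 1) ∧ ξ = -(p : K)⁻¹ * η ^ (p ^ h₁) := by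
  have hpos : 0 < p := hodd.pos
  have hfst : (p : K) * ξ + η ^ (p ^ h₁) = 0 ↔ ξ = -(p : K)⁻¹ * η ^ (p ^ h₁) := by
    constructor
    · intro h
      field_simp
      linear_combination h
    · rintro rfl
      field_simp
      ring
  simp only [Dmap, Prod.mk.injEq]
  rw [hfst, and_comm]
  refine and_congr_left fun hξ => ?_
  have hη : η ≠ 0 := by
    rintro rfl
    apply hne
    simp [hξ, hpos.ne']
  have hpow : ξ ^ (p ^ h₂) * (p : K) ^ (p ^ h₂) = -(η ^ (p ^ (h₁ + h₂) - 1) * η) := by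
    rw [← mul_pow, pow_sub_one_mul (pow_pos hpos _).ne', pow_add p, pow_mul,
      ← (hodd.pow : Odd (p ^ h₂)).neg_pow, hξ]
    congr 1
    field_simp
  have hp' : (p : K) ^ (p ^ h₂) ≠ 0 := pow_ne_zero _ hp
  constructor
  · intro h
    apply mul_right_cancel₀ hη
    linear_combination hpow - (p : K) ^ (p ^ h₂) * h
  · intro h
    apply mul_right_cancel₀ hp'
    rw [h] at hpow
    linear_combination hpow

/-- A pair `(ξ,η) ≠ (0,0)` in `Ω²` satisfies `𝒟(ξ,η) = (0,0)` if and only if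
`η^{p^h − 1} = p^{p^{h₂}+1}` and `ξ = −p⁻¹·η^{p^{h₁}}`; consequently there are exactly
`p^h − 1` nontrivial `p`-torsion points of `𝒟`, one for each root `η` of
`T^{p^h − 1} = p^{p^{h₂}+1}` in `Ω`. -/
theorem dynSys_p_torsion_points (p : ℕ) [Fact p.Prime] (hodd : Odd p) (h₁ h₂ : ℕ)
    (hh₁ : 2 ≤ h₁) (hh₂ : 2 ≤ h₂) (hcop : Nat.Coprime h₁ h₂)
    (Ω : Type) [Field Ω] [Algebra ℚ_[p] Ω] [IsAlgClosure ℚ_[p] Ω] :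
    (∀ ξ η : Ω, (ξ, η) ≠ (0, 0) →
      (Dmap p h₁ h₂ Ω (ξ, η) = (0, 0) ↔
        η ^ (p ^ (h₁ + h₂) - 1) = (p : Ω) ^ (p ^ h₂ + 1) ∧ ξ = -(p : Ω)⁻¹ * η ^ (p ^ h₁)))
    ∧ {x : Ω × Ω | x ≠ (0, 0) ∧ Dmap p h₁ h₂ Ω x = (0, 0)}.Finite
    ∧ {x : Ω × Ω | x ≠ (0, 0) ∧ Dmap p h₁ h₂ Ω x = (0, 0)}.ncard = p ^ (h₁ + h₂) - 1 := by
  have : CharZero Ω := charZero_of_injective_algebraMap (algebraMap ℚ_[p] Ω).injective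
  have : IsAlgClosed Ω := IsAlgClosure.isAlgClosed ℚ_[p]
  have hprime : p.Prime := Fact.out
  have hp : (p : Ω) ≠ 0 := Nat.cast_ne_zero.mpr hprime.ne_zero
  have hiff : ∀ ξ η : Ω, (ξ, η) ≠ (0, 0) → _ := fun ξ η => Dmap_eq_zero_iff hodd h₁ h₂ hp
  have hn : p ^ (h₁ + h₂) - 1 ≠ 0 :=
    (Nat.sub_pos_of_lt (Nat.one_lt_pow (by omega) hprime.one_lt)).ne'
  have hc : (p : Ω) ^ (p ^ h₂ + 1) ≠ 0 := pow_ne_zero _ hp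
  have hset : {x : Ω × Ω | x ≠ (0, 0) ∧ Dmap p h₁ h₂ Ω x = (0, 0)} =
      (fun η : Ω => (-(p : Ω)⁻¹ * η ^ (p ^ h₁), η)) ''
        (Polynomial.nthRootsFinset (p ^ (h₁ + h₂) - 1) ((p : Ω) ^ (p ^ h₂ + 1)) : Set Ω) := by
    ext ⟨ξ, η⟩
    simp only [Set.mem_ofPred_eq, Set.mem_image, Finset.mem_coe,
      Polynomial.mem_nthRootsFinset (Nat.pos_of_ne_zero hn)]
    constructor
    · rintro ⟨hne, h⟩
      obtain ⟨hroot, rfl⟩ := (hiff ξ η hne).mp h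
      exact ⟨η, hroot, rfl⟩
    · rintro ⟨η', h, heq⟩
      obtain ⟨rfl, rfl⟩ := Prod.mk.inj heq
      have hne : (-(p : Ω)⁻¹ * η' ^ (p ^ h₁), η') ≠ (0, 0) := by
        intro h0
        rw [(Prod.mk.inj h0).2, zero_pow hn] at h
        exact hc h.symm
      exact ⟨hne, (hiff _ _ hne).mpr ⟨h, rfl⟩⟩
  refine ⟨hiff, ?_, ?_⟩
  · rw [hset]
    exact (Finset.finite_toSet _).image _
  · rw [hset, Set.ncard_image_of_injective _ fun _ _ h => (Prod.mk.inj h).2,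
      Set.ncard_coe_finset, card_nthRootsFinset_of_isAlgClosed hn hc]
end
end

section
/- Assume moreover that h = h₁ + h₂ is odd, and let (ξ,η) ∈ Ω² with (ξ,η) ≠ (0,0) and 𝒟(ξ,η) = (0,0) (a nontrivial p-torsion point of 𝒟). Then ξ and η generate the same extension of U_h: the subfields U_h(ξ) and U_h(η) of Ω coincide. -/
noncomputable section

/-- If `c * x + y ^ n = 0` with `c ≠ 0` in the base field, then `x` lies in the field
generated by `y`. -/
theorem mem_adjoin_of_mul_add_pow_eq_zero {K L : Type*} [Field K] [Field L] [Algebra K L]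
    {c : K} (hc : c ≠ 0) {x y : L} {n : ℕ} (h : algebraMap K L c * x + y ^ n = 0) :
    x ∈ IntermediateField.adjoin K {y} := by
  have hc' : algebraMap K L c ≠ 0 := (map_ne_zero _).2 hc
  have hx : x = -(y ^ n) / algebraMap K L c := by
    rw [eq_div_iff hc', mul_comm]
    exact eq_neg_of_add_eq_zero_left h
  rw [hx]
  exact div_mem (neg_mem (pow_mem (IntermediateField.mem_adjoin_simple_self K y) n))
    (IntermediateField.algebraMap_mem _ c)

/-- Assume `h = h₁ + h₂` is odd and let `(ξ,η)` be a nontrivial `p`-torsion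
point of `𝒟`. With `U_h = ℚ_p(ζ)` the unramified extension of degree `h` of `ℚ_p` (`ζ` a
primitive `(p^h − 1)`-th root of unity in `Ω`), the coordinates `ξ` and `η` generate the same
extension of `U_h`: `U_h(ξ) = U_h(η)` as subfields of `Ω`. -/
theorem dynSys_p_torsion_same_field (p : ℕ) [Fact p.Prime] (hodd : Odd p) (h₁ h₂ : ℕ)
    (hh₁ : 2 ≤ h₁) (hh₂ : 2 ≤ h₂) (hcop : Nat.Coprime h₁ h₂) (hhodd : Odd (h₁ + h₂))
    (Ω : Type) [Field Ω] [Algebra ℚ_[p] Ω] [IsAlgClosure ℚ_[p] Ω]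
    (ζ : Ω) (hζ : IsPrimitiveRoot ζ (p ^ (h₁ + h₂) - 1))
    (Uh : IntermediateField ℚ_[p] Ω) (hUh : Uh = IntermediateField.adjoin ℚ_[p] {ζ})
    (ξ η : Ω) (hne : (ξ, η) ≠ (0, 0)) (htors : Dmap p h₁ h₂ Ω (ξ, η) = (0, 0)) :
    IntermediateField.adjoin ↥Uh {ξ} = IntermediateField.adjoin ↥Uh {η} := by
  have hp : (p : Uh) ≠ 0 := by
    have := charZero_of_injective_algebraMap (algebraMap ℚ_[p] Uh).injective
    exact Nat.cast_ne_zero.2 (Fact.out : p.Prime).ne_zero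
  simp only [Dmap, Prod.mk.injEq] at htors
  apply le_antisymm <;> rw [IntermediateField.adjoin_simple_le_iff]
  · refine mem_adjoin_of_mul_add_pow_eq_zero hp (n := p ^ h₁) ?_
    rw [map_natCast]
    exact htors.1
  · refine mem_adjoin_of_mul_add_pow_eq_zero hp (n := p ^ h₂) ?_
    rw [map_natCast]
    exact htors.2
end
end

section
/- Assume moreover that h = h₁ + h₂ is odd, and let (ξ,η) ∈ Ω² with (ξ,η) ≠ (0,0) and 𝒟(ξ,η) = (0,0) (a nontrivial p-torsion point of 𝒟). Then the extension U_h(ξ)/U_h has degree (p^h − 1)/2 and is totally ramified: its ramification index equals its degree (p^h − 1)/2 (equivalently, its residue field extension is trivial). -/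
noncomputable section

open Polynomial

theorem coprime_half_pow_add_one_half_pow_sub_one {p h₁ h₂ k M : ℕ} (hp : 0 < p)
    (hcop : Nat.Coprime h₁ h₂) (hhodd : Odd (h₁ + h₂))
    (hk : p ^ h₁ + 1 = 2 * k) (hM : p ^ (h₁ + h₂) - 1 = 2 * M) : Nat.Coprime k M := by
  have hgcd : Nat.gcd (2 * h₁) (h₁ + h₂) = 1 := by
    refine Nat.Coprime.mul_left ?_ ?_
    · exact (Nat.coprime_two_left).2 hhodd
    · simpa using hcop
  set d := Nat.gcd k M with hd
  have h1 : 2 * d ∣ p ^ h₁ + 1 := hk ▸ Nat.mul_dvd_mul_left 2 (Nat.gcd_dvd_left k M)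
  have h2 : 2 * d ∣ p ^ (h₁ + h₂) - 1 := hM ▸ Nat.mul_dvd_mul_left 2 (Nat.gcd_dvd_right k M)
  have h3 : 2 * d ∣ p ^ (2 * h₁) - 1 := by
    have : p ^ (2 * h₁) - 1 = (p ^ h₁ + 1) * (p ^ h₁ - 1) := by
      rw [mul_comm 2, pow_mul]
      simpa using Nat.sq_sub_sq (p ^ h₁) 1
    rw [this]
    exact h1.mul_right _
  have h4 : 2 * d ∣ p - 1 := by
    have := Nat.dvd_gcd h3 h2
    rwa [Nat.pow_sub_one_gcd_pow_sub_one, hgcd, pow_one] at this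
  have h5 : 2 * d ∣ p ^ h₁ - 1 := h4.trans (Nat.sub_one_dvd_pow_sub_one p h₁)
  have h6 : 2 * d ∣ 2 * 1 := by
    have := Nat.dvd_sub h1 h5
    have hpos := Nat.pow_pos (n := h₁) hp
    rwa [show p ^ h₁ + 1 - (p ^ h₁ - 1) = 2 * 1 by omega] at this
  exact Nat.dvd_one.1 (Nat.dvd_of_mul_dvd_mul_left two_pos h6)

section UnramifiedRing

variable {p : ℕ} [Fact p.Prime] {Ω : Type*} [NontriviallyNormedField Ω] [Algebra ℚ_[p] Ω]

/-- The canonical ring homomorphism from `ℤ_[p]` to a `ℚ_[p]`-algebra. -/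
def padicIntHom (p : ℕ) [Fact p.Prime] (Ω : Type*) [NontriviallyNormedField Ω]
    [Algebra ℚ_[p] Ω] : ℤ_[p] →+* Ω :=
  (algebraMap ℚ_[p] Ω).comp PadicInt.Coe.ringHom

/-- The subring `ℤ_[p][ζ]` of a `ℚ_[p]`-algebra. -/
def padicIntAdjoin (p : ℕ) [Fact p.Prime] {Ω : Type*} [NontriviallyNormedField Ω]
    [Algebra ℚ_[p] Ω] (ζ : Ω) : Subring Ω :=
  (eval₂RingHom (padicIntHom p Ω) ζ).range

theorem padicIntHom_mem_padicIntAdjoin (ζ : Ω) (a : ℤ_[p]) :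
    padicIntHom p Ω a ∈ padicIntAdjoin p ζ :=
  ⟨C a, by simp⟩

theorem self_mem_padicIntAdjoin (ζ : Ω) : ζ ∈ padicIntAdjoin p ζ :=
  ⟨X, by simp⟩

theorem padicIntAdjoin_induction {ζ : Ω} {P : (x : Ω) → Prop}
    (hC : ∀ a, P (padicIntHom p Ω a)) (hζ : P ζ)
    (hadd : ∀ x ∈ padicIntAdjoin p ζ, ∀ y ∈ padicIntAdjoin p ζ, P x → P y → P (x + y))
    (hmul : ∀ x ∈ padicIntAdjoin p ζ, ∀ y ∈ padicIntAdjoin p ζ, P x → P y → P (x * y))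
    {x : Ω} (hx : x ∈ padicIntAdjoin p ζ) : P x := by
  obtain ⟨f, rfl⟩ := hx
  induction f using Polynomial.induction_on with
  | C a => simpa using hC a
  | add f g hf hg =>
    rw [map_add]
    exact hadd _ ⟨f, rfl⟩ _ ⟨g, rfl⟩ hf hg
  | monomial n a h =>
    rw [pow_succ, ← mul_assoc, map_mul]
    exact hmul _ ⟨_, rfl⟩ _ ⟨_, rfl⟩ h (by simpa using hζ)

theorem norm_padicIntHom (hnorm : ∀ q : ℚ_[p], ‖algebraMap ℚ_[p] Ω q‖ = ‖q‖) (a : ℤ_[p]) :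
    ‖padicIntHom p Ω a‖ = ‖a‖ := by
  exact hnorm a

theorem norm_natCast_prime (hnorm : ∀ q : ℚ_[p], ‖algebraMap ℚ_[p] Ω q‖ = ‖q‖) :
    ‖(p : Ω)‖ = (p : ℝ)⁻¹ := by
  rw [← map_natCast (algebraMap ℚ_[p] Ω) p, hnorm, Padic.norm_p]

theorem norm_le_one_of_mem_padicIntAdjoin [IsUltrametricDist Ω]
    (hnorm : ∀ q : ℚ_[p], ‖algebraMap ℚ_[p] Ω q‖ = ‖q‖) {ζ : Ω} (hζ : ‖ζ‖ ≤ 1)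
    {x : Ω} (hx : x ∈ padicIntAdjoin p ζ) : ‖x‖ ≤ 1 := by
  refine padicIntAdjoin_induction (P := fun x => ‖x‖ ≤ 1) (fun a => ?_) hζ ?_ ?_ hx
  · rw [norm_padicIntHom hnorm]
    exact PadicInt.norm_le_one a
  · intro x _ y _ hx hy
    exact (IsUltrametricDist.norm_add_le_max x y).trans (max_le hx hy)
  · intro x _ y _ hx hy
    rw [norm_mul]
    exact mul_le_one₀ hx (norm_nonneg y) hy

theorem isCompact_padicIntAdjoin (hnorm : ∀ q : ℚ_[p], ‖algebraMap ℚ_[p] Ω q‖ = ‖q‖)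
    {ζ : Ω} {n : ℕ} (hn : n ≠ 0) (hζ : ζ ^ n = 1) :
    IsCompact (padicIntAdjoin p ζ : Set Ω) := by
  have hcont : Continuous (padicIntHom p Ω) :=
    (AddMonoidHomClass.isometry_of_norm _ (norm_padicIntHom hnorm)).continuous
  have heq : (padicIntAdjoin p ζ : Set Ω) =
      Set.range (fun a : Fin n → ℤ_[p] => ∑ i, padicIntHom p Ω (a i) * ζ ^ (i : ℕ)) := by
    apply Set.Subset.antisymm
    · rintro _ ⟨f, rfl⟩
      have hmonic : (X ^ n - 1 : ℤ_[p][X]).Monic := monic_X_pow_sub_C 1 hn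
      have hdeg : (f %ₘ (X ^ n - 1)).degree < (n : WithBot ℕ) := by
        have := degree_modByMonic_lt f hmonic
        rwa [← C_1, degree_X_pow_sub_C (Nat.pos_of_ne_zero hn)] at this
      refine ⟨fun i => (f %ₘ (X ^ n - 1)).coeff i, ?_⟩
      have hf : f.eval₂ (padicIntHom p Ω) ζ =
          (f %ₘ (X ^ n - 1)).eval₂ (padicIntHom p Ω) ζ := by
        conv_lhs => rw [← modByMonic_add_div f (X ^ n - 1)]
        simp [eval₂_add, eval₂_mul, hζ]
      rw [coe_eval₂RingHom, hf]
      by_cases h0 : f %ₘ (X ^ n - 1) = 0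
      · simp [h0]
      · rw [eval₂_eq_sum_range' _ ((natDegree_lt_iff_degree_lt h0).2 hdeg), Finset.sum_range]
    · rintro _ ⟨a, rfl⟩
      exact Subring.sum_mem _ fun i _ => Subring.mul_mem _
        (padicIntHom_mem_padicIntAdjoin ζ _) (Subring.pow_mem _ (self_mem_padicIntAdjoin ζ) _)
  rw [heq]
  exact isCompact_range (by fun_prop)

theorem PadicInt.exists_pow_prime_pow_eq_add (a : ℤ_[p]) (m : ℕ) :
    ∃ b : ℤ_[p], a ^ p ^ m = a + p * b := by
  have h : PadicInt.toZMod (a ^ p ^ m - a) = 0 := by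
    rw [map_sub, map_pow, ZMod.pow_card_pow, sub_self]
  rw [← RingHom.mem_ker, PadicInt.ker_toZMod, PadicInt.maximalIdeal_eq_span_p,
    Ideal.mem_span_singleton] at h
  obtain ⟨b, hb⟩ := h
  exact ⟨b, by rw [← hb]; ring⟩

theorem exists_pow_prime_pow_eq_add_of_mem_padicIntAdjoin {ζ : Ω} {m : ℕ}
    (hζ : ζ ^ p ^ m = ζ) {x : Ω} (hx : x ∈ padicIntAdjoin p ζ) :
    ∃ r ∈ padicIntAdjoin p ζ, x ^ p ^ m = x + p * r := by
  refine padicIntAdjoin_induction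
    (P := fun x => ∃ r ∈ padicIntAdjoin p ζ, x ^ p ^ m = x + p * r) (fun a => ?_) ?_ ?_ ?_ hx
  · obtain ⟨b, hb⟩ := PadicInt.exists_pow_prime_pow_eq_add a m
    exact ⟨_, padicIntHom_mem_padicIntAdjoin ζ b, by rw [← map_pow, hb]; simp⟩
  · exact ⟨0, Subring.zero_mem _, by simp [hζ]⟩
  · rintro x hx y hy ⟨r, hr, hxr⟩ ⟨s, hs, hys⟩
    obtain ⟨t, ht⟩ := exists_add_pow_prime_pow_eq (Fact.out : p.Prime)
      (⟨x, hx⟩ : padicIntAdjoin p ζ) ⟨y, hy⟩ m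
    have ht' := congrArg Subtype.val ht
    push_cast at ht'
    refine ⟨r + s + x * y * t, ?_, ?_⟩
    · exact add_mem (add_mem hr hs) (mul_mem (mul_mem hx hy) t.2)
    · rw [ht', hxr, hys]
      ring
  · rintro x hx y hy ⟨r, hr, hxr⟩ ⟨s, hs, hys⟩
    refine ⟨x * s + r * y + p * r * s, ?_, ?_⟩
    · exact add_mem (add_mem (mul_mem hx hs) (mul_mem hr hy))
        (mul_mem (mul_mem (natCast_mem _ p) hr) hs)
    · rw [mul_pow, hxr, hys]
      ring

/-- An element of `ℤ_[p][ζ]`, with `ζ` a root of unity of order prime to `p`, that has norm less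
than one is divisible by `p`. -/
theorem exists_eq_prime_mul_of_norm_lt_one
    (hnorm : ∀ q : ℚ_[p], ‖algebraMap ℚ_[p] Ω q‖ = ‖q‖) {ζ : Ω} {m : ℕ} (hm : m ≠ 0)
    (hζ : ζ ^ (p ^ m - 1) = 1) {x : Ω} (hx : x ∈ padicIntAdjoin p ζ) (hx1 : ‖x‖ < 1) :
    ∃ y ∈ padicIntAdjoin p ζ, x = p * y := by
  have hp1 : 1 < p := (Fact.out : p.Prime).one_lt
  have hq : 1 < p ^ m := Nat.one_lt_pow hm hp1
  have hζq : ∀ n : ℕ, ζ ^ p ^ (m * n) = ζ := by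
    have h1 : ζ ^ p ^ m = ζ := by
      rw [← Nat.sub_add_cancel hq.le, pow_succ, hζ, one_mul]
    intro n
    induction n with
    | zero => simp
    | succ n ih => rw [Nat.mul_succ, pow_add, pow_mul, ih, h1]
  have hclosed : IsClosed ((fun y : Ω => (p : Ω) * y) '' (padicIntAdjoin p ζ : Set Ω)) :=
    ((isCompact_padicIntAdjoin hnorm (by omega) hζ).image (by fun_prop)).isClosed
  have hlim : Filter.Tendsto (fun n : ℕ => x - x ^ p ^ (m * n)) Filter.atTop (nhds (x - 0)) := by
    refine tendsto_const_nhds.sub ((tendsto_pow_atTop_nhds_zero_of_norm_lt_one hx1).comp ?_)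
    refine Filter.tendsto_atTop_mono (fun n => ?_) Filter.tendsto_id
    exact (Nat.le_mul_of_pos_left n (Nat.pos_of_ne_zero hm)).trans (Nat.lt_pow_self hp1).le
  have hmem := hclosed.mem_of_tendsto hlim (Filter.Eventually.of_forall fun n => by
    obtain ⟨r, hr, hxr⟩ := exists_pow_prime_pow_eq_add_of_mem_padicIntAdjoin (hζq n) hx
    exact ⟨-r, neg_mem hr, by simp only [hxr]; ring⟩)
  obtain ⟨y, hy, hxy⟩ := hmem
  exact ⟨y, hy, by simpa using hxy.symm⟩

theorem exists_norm_eq_zpow_of_mem_padicIntAdjoin [IsUltrametricDist Ω]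
    (hnorm : ∀ q : ℚ_[p], ‖algebraMap ℚ_[p] Ω q‖ = ‖q‖) {ζ : Ω} {m : ℕ} (hm : m ≠ 0)
    (hζ : ζ ^ (p ^ m - 1) = 1) {x : Ω} (hx : x ∈ padicIntAdjoin p ζ) (hx0 : x ≠ 0) :
    ∃ n : ℤ, ‖x‖ = (p : ℝ) ^ n := by
  have hp1 : 1 < p := (Fact.out : p.Prime).one_lt
  have hp0 : (p : ℝ) ≠ 0 := by positivity
  have hζ1 : ‖ζ‖ ≤ 1 := by
    have hq : 1 < p ^ m := Nat.one_lt_pow hm hp1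
    have := congrArg norm hζ
    rw [norm_pow, norm_one] at this
    exact (pow_eq_one_iff_of_nonneg (norm_nonneg ζ) (by omega)).1 this |>.le
  obtain ⟨N, hN⟩ := exists_pow_lt_of_lt_one (norm_pos_iff.2 hx0)
    (inv_lt_one_of_one_lt₀ (by exact_mod_cast hp1 : (1 : ℝ) < p))
  induction N generalizing x with
  | zero =>
    exact absurd (norm_le_one_of_mem_padicIntAdjoin hnorm hζ1 hx) (by simpa using hN)
  | succ N ih =>
    rcases (norm_le_one_of_mem_padicIntAdjoin hnorm hζ1 hx).lt_or_eq with h | h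
    · obtain ⟨y, hy, rfl⟩ := exists_eq_prime_mul_of_norm_lt_one hnorm hm hζ hx h
      rw [norm_mul, norm_natCast_prime hnorm] at hN ⊢
      obtain ⟨n, hn⟩ := ih hy (right_ne_zero_of_mul hx0) (by
        rw [pow_succ'] at hN
        exact lt_of_mul_lt_mul_left hN (by positivity))
      exact ⟨n - 1, by rw [hn, zpow_sub_one₀ hp0, mul_comm]⟩
    · exact ⟨0, by simp [h]⟩

/-- The value group of `ℚ_[p](ζ)`, with `ζ` a root of unity of order prime to `p`, is generated
by `p`. -/
theorem exists_norm_eq_zpow_of_mem_adjoin [IsUltrametricDist Ω] [Algebra.IsAlgebraic ℚ_[p] Ω]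
    (hnorm : ∀ q : ℚ_[p], ‖algebraMap ℚ_[p] Ω q‖ = ‖q‖) {ζ : Ω} {m : ℕ} (hm : m ≠ 0)
    (hζ : ζ ^ (p ^ m - 1) = 1) {x : Ω} (hx : x ∈ IntermediateField.adjoin ℚ_[p] {ζ})
    (hx0 : x ≠ 0) : ∃ n : ℤ, ‖x‖ = (p : ℝ) ^ n := by
  have hp1 : 1 < p := (Fact.out : p.Prime).one_lt
  have hp0 : (p : ℝ) ≠ 0 := by positivity
  have key : ∃ n : ℕ, (p : Ω) ^ n * x ∈ padicIntAdjoin p ζ := by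
    clear hx0
    rw [← IntermediateField.mem_toSubalgebra,
      IntermediateField.adjoin_simple_toSubalgebra_of_isAlgebraic
        (Algebra.IsAlgebraic.isAlgebraic ζ)] at hx
    have hpmem (n : ℕ) : (p : Ω) ^ n ∈ padicIntAdjoin p ζ := pow_mem (natCast_mem _ p) n
    induction hx using Algebra.adjoin_induction with
    | mem x hx => exact ⟨0, by simpa [Set.mem_singleton_iff.1 hx] using self_mem_padicIntAdjoin ζ⟩
    | algebraMap q =>
      obtain ⟨n, hn⟩ := pow_unbounded_of_one_lt ‖q‖ (by exact_mod_cast hp1 : (1 : ℝ) < p)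
      refine ⟨n, ?_⟩
      have hle : ‖(p : ℚ_[p]) ^ n * q‖ ≤ 1 := by
        rw [norm_mul, norm_pow, Padic.norm_p, inv_pow, inv_mul_le_one₀ (by positivity)]
        exact hn.le
      have hmem := padicIntHom_mem_padicIntAdjoin ζ (⟨_, hle⟩ : ℤ_[p])
      change algebraMap ℚ_[p] Ω ((p : ℚ_[p]) ^ n * q) ∈ _ at hmem
      simpa using hmem
    | add x y _ _ hx hy =>
      obtain ⟨a, ha⟩ := hx
      obtain ⟨b, hb⟩ := hy
      refine ⟨a + b, ?_⟩
      convert add_mem (mul_mem (hpmem b) ha) (mul_mem (hpmem a) hb) using 1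
      ring
    | mul x y _ _ hx hy =>
      obtain ⟨a, ha⟩ := hx
      obtain ⟨b, hb⟩ := hy
      refine ⟨a + b, ?_⟩
      convert mul_mem ha hb using 1
      ring
  obtain ⟨n, hn⟩ := key
  have hpΩ : (p : Ω) ≠ 0 := by
    rw [← norm_pos_iff, norm_natCast_prime hnorm]
    positivity
  obtain ⟨k, hk⟩ := exists_norm_eq_zpow_of_mem_padicIntAdjoin hnorm hm hζ hn
    (mul_ne_zero (pow_ne_zero n hpΩ) hx0)
  refine ⟨k + n, ?_⟩
  rw [norm_mul, norm_pow, norm_natCast_prime hnorm] at hk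
  rw [zpow_add₀ hp0, ← hk, zpow_natCast, mul_comm, ← mul_assoc, ← mul_pow,
    mul_inv_cancel₀ hp0, one_pow, one_mul]

end UnramifiedRing

/-- If every nonzero element of `K` has norm a power of `p`, then a root `ξ` of `X ^ M - a` with
`‖a‖ = p ^ (-k)` and `k` coprime to `M` has degree `M` over `K`. -/
theorem finrank_adjoin_eq_of_norm_pow {F Ω : Type*} [Field F] [NormedField Ω] [IsAlgClosed Ω]
    [Algebra F Ω] {K : IntermediateField F Ω} {p k M : ℕ} (hp : 1 < p) (hM : 0 < M)
    (hcop : Nat.Coprime k M) (hK : ∀ x ∈ K, x ≠ 0 → ∃ n : ℤ, ‖x‖ = (p : ℝ) ^ n)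
    (a : K) (ha : ‖(a : Ω)‖ = ((p : ℝ)⁻¹) ^ k) {ξ : Ω} (hξ : ξ ^ M = a) :
    Module.finrank K (IntermediateField.adjoin K {ξ}) = M := by
  have hmonic : (X ^ M - C a : K[X]).Monic := monic_X_pow_sub_C a hM.ne'
  have hroot : aeval ξ (X ^ M - C a : K[X]) = 0 := by simp [hξ]
  have hint : IsIntegral K ξ := ⟨_, hmonic, hroot⟩
  rw [IntermediateField.adjoin.finrank hint]
  have hdvd : minpoly K ξ ∣ X ^ M - C a := minpoly.dvd K ξ hroot
  have hpR : (1 : ℝ) < p := by exact_mod_cast hp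
  apply le_antisymm
  · simpa using natDegree_le_of_dvd hdvd hmonic.ne_zero
  · set f := (minpoly K ξ).map (algebraMap K Ω) with hf
    have hfm : f.Monic := (minpoly.monic hint).map _
    have hsplit : f.Splits := IsAlgClosed.splits f
    have hdeg : f.natDegree = (minpoly K ξ).natDegree := natDegree_map _
    have hcoeff := hsplit.coeff_zero_eq_prod_roots_of_monic hfm
    have hroots : ∀ z ∈ f.roots, ‖z‖ ^ M = ((p : ℝ)⁻¹) ^ k := by
      intro z hz
      have hz0 : aeval z (minpoly K ξ) = 0 := by
        have := (mem_roots'.1 hz).2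
        rwa [IsRoot.def, hf, eval_map_algebraMap] at this
      have hz1 := aeval_eq_zero_of_dvd_aeval_eq_zero hdvd hz0
      have hz2 : z ^ M = a := by simpa [sub_eq_zero] using hz1
      rw [← norm_pow, hz2, ha]
    have hnormprod : ‖f.coeff 0‖ ^ M = ((p : ℝ)⁻¹) ^ (k * f.natDegree) := by
      have hprod : ‖f.roots.prod‖ ^ M = ((p : ℝ)⁻¹) ^ (k * f.roots.card) := by
        generalize f.roots = s at hroots
        induction s using Multiset.induction_on with
        | empty => simp
        | cons z s ih =>
          rw [Multiset.prod_cons, norm_mul, mul_pow, hroots z (Multiset.mem_cons_self z s),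
            ih fun y hy => hroots y (Multiset.mem_cons_of_mem hy), Multiset.card_cons]
          ring
      rw [hcoeff, norm_mul, norm_pow, norm_neg, norm_one, one_pow, one_mul, hprod,
        hsplit.natDegree_eq_card_roots]
    have hne : f.coeff 0 ≠ 0 := by
      intro h
      rw [h, norm_zero, zero_pow hM.ne'] at hnormprod
      exact (pow_pos (inv_pos.2 (zero_lt_one.trans hpR)) _).ne hnormprod
    obtain ⟨n, hn⟩ := hK (f.coeff 0) (by rw [hf, coeff_map]; exact SetLike.coe_mem _) hne
    rw [hn, ← zpow_natCast, ← zpow_mul, inv_pow, ← zpow_natCast, ← zpow_neg] at hnormprod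
    have hexp := zpow_right_injective₀ (zero_lt_one.trans hpR) hpR.ne' hnormprod
    have hMd : M ∣ k * f.natDegree := by
      rw [← Int.natCast_dvd_natCast]
      exact ⟨-n, by linarith⟩
    rw [← hdeg]
    refine Nat.le_of_dvd ?_ (hcop.symm.dvd_of_dvd_mul_left hMd)
    rw [hdeg]
    exact minpoly.natDegree_pos hint

theorem pow_eq_of_Dmap_eq_zero {p h₁ h₂ : ℕ} {Ω : Type} [Field Ω] (hodd : Odd p)
    (hp : (p : Ω) ≠ 0) {ξ η : Ω} (hne : (ξ, η) ≠ (0, 0))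
    (htors : Dmap p h₁ h₂ Ω (ξ, η) = (0, 0)) :
    ξ ^ (p ^ (h₁ + h₂) - 1) = (p : Ω) ^ (p ^ h₁ + 1) := by
  obtain ⟨h1, h2⟩ := Prod.mk.inj htors
  simp only at h1 h2
  have hppos : 0 < p := hodd.pos
  have hξ : ξ ≠ 0 := by
    rintro rfl
    rw [zero_pow (pow_pos hppos _).ne', add_zero] at h2
    exact hne (by simpa [hp] using h2)
  have h3 : ((p : Ω) * η) ^ p ^ h₁ = -ξ ^ p ^ (h₁ + h₂) := by
    rw [eq_neg_of_add_eq_zero_left h2, hodd.pow.neg_pow, ← pow_mul, ← pow_add, add_comm h₂]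
  rw [mul_pow, eq_neg_of_add_eq_zero_right h1] at h3
  apply mul_right_cancel₀ hξ
  rw [← pow_succ, Nat.sub_add_cancel (Nat.one_le_pow _ _ hppos), pow_succ]
  linear_combination h3

/-- Assume `h = h₁ + h₂` is odd, and let `(ξ,η)` be a nontrivial `p`-torsion
point of `𝒟`. With `U_h = ℚ_p(ζ)` the unramified extension of degree `h` of `ℚ_p` inside `Ω`,
the extension `U_h(ξ)/U_h` has degree `(p^h − 1)/2` and is totally ramified: its ramification
index equals its degree, i.e. (since `p` is a uniformizer of the unramified extension `U_h`)
`U_h(ξ)` contains an element `π` with `v(π) = 1/deg`, that is `‖π‖^{(p^h−1)/2} = ‖p‖ = p⁻¹`. -/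
theorem dynSys_p_torsion_totally_ramified (p : ℕ) [Fact p.Prime] (hodd : Odd p) (h₁ h₂ : ℕ)
    (hh₁ : 2 ≤ h₁) (hh₂ : 2 ≤ h₂) (hcop : Nat.Coprime h₁ h₂) (hhodd : Odd (h₁ + h₂))
    (Ω : Type) [NontriviallyNormedField Ω] [Algebra ℚ_[p] Ω] [IsAlgClosure ℚ_[p] Ω]
    [IsUltrametricDist Ω]
    (hnorm : ∀ q : ℚ_[p], ‖algebraMap ℚ_[p] Ω q‖ = ‖q‖)
    (ζ : Ω) (hζ : IsPrimitiveRoot ζ (p ^ (h₁ + h₂) - 1))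
    (Uh : IntermediateField ℚ_[p] Ω) (hUh : Uh = IntermediateField.adjoin ℚ_[p] {ζ})
    (ξ η : Ω) (hne : (ξ, η) ≠ (0, 0)) (htors : Dmap p h₁ h₂ Ω (ξ, η) = (0, 0)) :
    Module.finrank ↥Uh ↥(IntermediateField.adjoin ↥Uh {ξ}) = (p ^ (h₁ + h₂) - 1) / 2
    ∧ ∃ π ∈ IntermediateField.adjoin ↥Uh {ξ},
        ‖π‖ ^ ((p ^ (h₁ + h₂) - 1) / 2) = ((p : ℝ))⁻¹ := by
  have hp1 : 1 < p := (Fact.out : p.Prime).one_lt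
  have hpR : (p : ℝ) ≠ 0 := by positivity
  have hnp := norm_natCast_prime hnorm
  have hpΩ : (p : Ω) ≠ 0 := by
    rw [← norm_pos_iff, hnp]
    positivity
  have : IsAlgClosed Ω := IsAlgClosure.isAlgClosed ℚ_[p]
  have : Algebra.IsAlgebraic ℚ_[p] Ω := IsAlgClosure.isAlgebraic
  obtain ⟨k, hk⟩ : ∃ k, p ^ h₁ + 1 = 2 * k := (hodd.pow.add_one).two_dvd
  obtain ⟨M, hM⟩ : ∃ M, p ^ (h₁ + h₂) - 1 = 2 * M :=
    (Nat.Odd.sub_odd (hodd.pow (n := h₁ + h₂)) odd_one).two_dvd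
  have hh : h₁ + h₂ ≠ 0 := by omega
  have hMpos : 0 < M := by
    have := Nat.one_lt_pow hh hp1
    omega
  have hcopkM := coprime_half_pow_add_one_half_pow_sub_one hodd.pos hcop hhodd hk hM
  have hpow := pow_eq_of_Dmap_eq_zero hodd hpΩ hne htors
  rw [hM, hk, mul_comm 2, mul_comm 2, pow_mul, pow_mul, sq_eq_sq_iff_eq_or_eq_neg] at hpow
  have hnormξ : ‖ξ‖ ^ M = ((p : ℝ)⁻¹) ^ k := by
    rw [← norm_pow, ← hnp, ← norm_pow]
    rcases hpow with h | h <;> simp [h]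
  have hmemK : ξ ^ M ∈ Uh := by
    have hmem : (p : Ω) ^ k ∈ Uh := pow_mem (natCast_mem Uh p) k
    rcases hpow with h | h
    · rwa [h]
    · rw [h]
      exact neg_mem hmem
  rw [hM, Nat.mul_div_cancel_left M two_pos]
  constructor
  · refine finrank_adjoin_eq_of_norm_pow hp1 hMpos hcopkM ?_ ⟨ξ ^ M, hmemK⟩ ?_ rfl
    · intro x hx hx0
      rw [hUh] at hx
      exact exists_norm_eq_zpow_of_mem_adjoin hnorm hh hζ.pow_eq_one hx hx0
    · rw [norm_pow, hnormξ]
  · have hbez : (k : ℤ) * k.gcdA M + M * k.gcdB M = 1 := by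
      rw [← Nat.gcd_eq_gcd_ab, hcopkM, Nat.cast_one]
    refine ⟨ξ ^ k.gcdA M * (p : Ω) ^ k.gcdB M, mul_mem (zpow_mem
      (IntermediateField.mem_adjoin_simple_self Uh ξ) _) (zpow_mem (natCast_mem _ p) _), ?_⟩
    rw [norm_mul, norm_zpow, norm_zpow, hnp, mul_pow, ← zpow_natCast, ← zpow_mul, mul_comm _ (M : ℤ),
      zpow_mul, zpow_natCast, hnormξ, ← zpow_natCast, ← zpow_mul, ← zpow_natCast, ← zpow_mul,
      mul_comm _ (M : ℤ), ← zpow_add₀ (inv_ne_zero hpR), hbez, zpow_one]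
end
end

section
/- Assume moreover that h = h₁ + h₂ is odd. Then for each i ∈ {1,2}, the polynomial T^{(p^h − 1)/2} − p^{(p^{h_i} + 1)/2} is irreducible over U_h. -/
noncomputable section

open Polynomial

/-- Over `ℤ_[p]`, raising a polynomial to the power `p ^ n` agrees with substituting `X ^ p ^ n`
modulo `p`. -/
theorem PadicInt.exists_pow_eq_expand_add (p : ℕ) [Fact p.Prime] (n : ℕ) (f : ℤ_[p][X]) :
    ∃ g : ℤ_[p][X], f ^ p ^ n = expand ℤ_[p] (p ^ n) f + C (p : ℤ_[p]) * g := by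
  have hdvd : C (p : ℤ_[p]) ∣ f ^ p ^ n - expand ℤ_[p] (p ^ n) f := by
    rw [C_dvd_iff_dvd_coeff]
    intro i
    have hmap : (f ^ p ^ n - expand ℤ_[p] (p ^ n) f).map PadicInt.toZMod = 0 := by
      have hexpand (g : (ZMod p)[X]) : expand (ZMod p) (p ^ n) g = g ^ p ^ n := by
        induction n with
        | zero => simp
        | succ n ih => rw [pow_succ', ← expand_expand, ih, map_pow, ZMod.expand_card, ← pow_mul]
      rw [Polynomial.map_sub, Polynomial.map_pow, map_expand, hexpand, sub_self]
    have hi : PadicInt.toZMod ((f ^ p ^ n - expand ℤ_[p] (p ^ n) f).coeff i) = 0 := by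
      rw [← coeff_map, hmap, coeff_zero]
    rwa [← RingHom.mem_ker, PadicInt.ker_toZMod, PadicInt.maximalIdeal_eq_span_p,
      Ideal.mem_span_singleton] at hi
  obtain ⟨g, hg⟩ := hdvd
  exact ⟨g, by rw [← hg]; ring⟩

section AbsoluteValue

variable {L : Type*} [Field L] {v : AbsoluteValue L ℝ}

theorem AbsoluteValue.eval₂_le_one_of_isNonarchimedean (hv : IsNonarchimedean v) {R : Type*}
    [CommRing R] (φ : R →+* L) (hφ : ∀ a, v (φ a) ≤ 1) {z : L} (hz : v z ≤ 1) (f : R[X]) :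
    v (f.eval₂ φ z) ≤ 1 := by
  induction f using Polynomial.induction_on' with
  | add f g hf hg =>
    rw [eval₂_add]
    exact (hv _ _).trans (max_le hf hg)
  | monomial n a =>
    rw [eval₂_monomial, map_mul, map_pow]
    exact mul_le_one₀ (hφ a) (by positivity) (pow_le_one₀ (by positivity) hz)

/-- If `z` is a root of unity of order dividing `p ^ h - 1`, then the absolute value of any nonzero
element of `ℤ_[p][z]` is a power of that of `p`. -/
theorem AbsoluteValue.exists_eval₂_padicInt_eq_pow (hv : IsNonarchimedean v) {p : ℕ}
    [Fact p.Prime] (φ : ℤ_[p] →+* L) (hφ : ∀ a, v (φ a) ≤ 1) (hp : v (p : L) < 1)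
    {h : ℕ} (hh : h ≠ 0) {z : L} (hz : z ^ p ^ h = z) {f : ℤ_[p][X]} (hf : f.eval₂ φ z ≠ 0) :
    ∃ k : ℕ, v (f.eval₂ φ z) = v (p : L) ^ k := by
  have hq : 1 < p ^ h := Nat.one_lt_pow hh (Fact.out : p.Prime).one_lt
  have hz1 : v z ≤ 1 := by
    by_contra! hlt
    have := pow_lt_pow_right₀ hlt hq
    rw [pow_one, ← map_pow, hz] at this
    exact this.false
  have hle := v.eval₂_le_one_of_isNonarchimedean hv φ hφ hz1
  obtain ⟨N, hN⟩ := exists_pow_lt_of_lt_one (v.pos hf) hp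
  clear hf
  induction N generalizing f with
  | zero => exact absurd hN (by simpa using hle f)
  | succ N ih =>
    rcases (hle f).eq_or_lt with h1 | h1
    · exact ⟨0, by simpa using h1⟩
    obtain ⟨g, hg⟩ := PadicInt.exists_pow_eq_expand_add p h f
    have hpos : 0 < v (f.eval₂ φ z) := (pow_nonneg (v.nonneg _) _).trans_lt hN
    have heq : v (f.eval₂ φ z) = v (p : L) * v (g.eval₂ φ z) := by
      have hg' : f.eval₂ φ z ^ p ^ h + -f.eval₂ φ z = p * g.eval₂ φ z := by
        rw [← eval₂_pow, hg, eval₂_add, eval₂_eq_eval_map φ (p := expand ℤ_[p] (p ^ h) f),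
          map_expand, expand_eval, hz, ← eval₂_eq_eval_map, eval₂_mul, eval₂_C, map_natCast]
        ring
      have hlt : v (f.eval₂ φ z ^ p ^ h) < v (-f.eval₂ φ z) := by
        rw [map_neg_eq_map, map_pow]
        exact pow_lt_self_of_lt_one₀ hpos h1 hq
      rw [← map_mul, ← hg', hv.add_eq_right_of_lt hlt, map_neg_eq_map]
    have hppos : 0 < v (p : L) := (v.nonneg _).lt_of_ne' fun h0 => by simp [heq, h0] at hpos
    rw [heq, pow_succ'] at hN
    obtain ⟨k, hk⟩ := ih (lt_of_mul_lt_mul_left hN hppos.le)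
    exact ⟨k + 1, by rw [heq, hk, pow_succ']⟩

/-- The extension of `ℚ_[p]` generated by a root of unity of order dividing `p ^ h - 1` is
unramified: its value group is generated by the absolute value of `p`. -/
theorem AbsoluteValue.exists_eq_zpow_of_mem_adjoin_padic (hv : IsNonarchimedean v) {p : ℕ}
    [Fact p.Prime] [Algebra ℚ_[p] L] (hext : ∀ a : ℚ_[p], v (algebraMap ℚ_[p] L a) = ‖a‖)
    {h : ℕ} (hh : h ≠ 0) {z : L} (hzint : IsAlgebraic ℚ_[p] z) (hz : z ^ p ^ h = z) {c : L}
    (hc : c ∈ IntermediateField.adjoin ℚ_[p] {z}) (hc0 : c ≠ 0) :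
    ∃ k : ℤ, v c = v (p : L) ^ k := by
  have hvp : v (p : L) = (p : ℝ)⁻¹ := by
    rw [← map_natCast (algebraMap ℚ_[p] L), hext, Padic.norm_p]
  have hp1 : (1 : ℝ) < p := mod_cast (Fact.out : p.Prime).one_lt
  rw [← IntermediateField.mem_toSubalgebra,
    IntermediateField.adjoin_simple_toSubalgebra_of_isAlgebraic hzint,
    Algebra.adjoin_singleton_eq_range_aeval] at hc
  obtain ⟨F, rfl⟩ := hc
  obtain ⟨b, hb, hF⟩ := IsLocalization.integerNormalization_spec (nonZeroDivisors ℤ_[p]) F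
  set f := IsLocalization.integerNormalization (nonZeroDivisors ℤ_[p]) F
  have hb0 : (b : ℚ_[p]) ≠ 0 := by simpa using nonZeroDivisors.ne_zero hb
  have hb0' : algebraMap ℚ_[p] L b ≠ 0 := by simpa using hb0
  have heval : f.eval₂ ((algebraMap ℚ_[p] L).comp (algebraMap ℤ_[p] ℚ_[p])) z =
      algebraMap ℚ_[p] L b * aeval z F := by
    rw [← eval₂_map, hF, ← aeval_def, ← IsScalarTower.algebraMap_smul ℚ_[p] b F, map_smul,
      Algebra.smul_def]
    rfl
  obtain ⟨k, hk⟩ := v.exists_eval₂_padicInt_eq_pow hv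
    ((algebraMap ℚ_[p] L).comp (algebraMap ℤ_[p] ℚ_[p]))
    (fun a => by simpa [hext] using a.norm_le_one)
    (by rw [hvp]; exact inv_lt_one_of_one_lt₀ hp1) hh hz (f := f)
    (by rw [heval]; exact mul_ne_zero hb0' hc0)
  have hp0 : v (p : L) ≠ 0 := by rw [hvp]; positivity
  refine ⟨k - (b : ℚ_[p]).valuation, ?_⟩
  rw [heval, map_mul, hext, Padic.norm_eq_zpow_neg_valuation hb0, zpow_neg, ← inv_zpow, ← hvp] at hk
  rw [zpow_sub₀ hp0, zpow_natCast, ← hk]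
  exact (mul_div_cancel_left₀ _ (zpow_ne_zero _ hp0)).symm

/-- A slope criterion: if the value group of `K` is generated by the absolute value of `ϖ`, then
`X ^ n - ϖ ^ m` is irreducible over `K` whenever `n` and `m` are coprime. -/
theorem AbsoluteValue.irreducible_X_pow_sub_C_pow {K : Type*} [Field K] [Algebra K L]
    [IsAlgClosed L] {ϖ : K} (hϖ0 : ϖ ≠ 0) (hϖ : v (algebraMap K L ϖ) < 1)
    (hval : ∀ c : K, c ≠ 0 → ∃ k : ℤ, v (algebraMap K L c) = v (algebraMap K L ϖ) ^ k)
    {n m : ℕ} (hn : n ≠ 0) (hnm : n.Coprime m) :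
    Irreducible ((X : K[X]) ^ n - C (ϖ ^ m)) := by
  set w := v (algebraMap K L ϖ)
  have hwpos : 0 < w := v.pos (by simpa using hϖ0)
  obtain ⟨α, hα⟩ := IsAlgClosed.exists_pow_nat_eq (algebraMap K L (ϖ ^ m)) hn.bot_lt
  have hmonic : ((X : K[X]) ^ n - C (ϖ ^ m)).Monic := monic_X_pow_sub_C _ hn
  have hroot : aeval α ((X : K[X]) ^ n - C (ϖ ^ m)) = 0 := by simp [hα]
  have hint : IsIntegral K α := ⟨_, hmonic, hroot⟩
  have hdvd := minpoly.dvd K α hroot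
  set g := minpoly K α
  have hgm : g.Monic := minpoly.monic hint
  have hg0 : g.coeff 0 ≠ 0 := by
    refine minpoly.coeff_zero_ne_zero hint ?_
    rintro rfl
    rw [zero_pow hn, eq_comm] at hα
    simp [hϖ0] at hα
  have hsplits := IsAlgClosed.splits (g.map (algebraMap K L))
  have hcoeff := hsplits.coeff_zero_eq_prod_roots_of_monic (hgm.map _)
  have hroots : ∀ r ∈ (g.map (algebraMap K L)).roots, v r ^ n = w ^ m := by
    intro r hr
    have h0 : aeval r ((X : K[X]) ^ n - C (ϖ ^ m)) = 0 :=
      aeval_eq_zero_of_dvd_aeval_eq_zero hdvd (by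
        simpa [eval_map_algebraMap] using (mem_roots'.1 hr).2)
    have h1 : r ^ n = algebraMap K L ϖ ^ m := by simpa [sub_eq_zero] using h0
    rw [← map_pow, h1, map_pow]
  obtain ⟨k, hk⟩ := hval _ hg0
  have hprod : v (g.map (algebraMap K L)).roots.prod ^ n = w ^ (m * g.natDegree) := by
    rw [map_multiset_prod, ← Multiset.prod_map_pow, Multiset.map_congr rfl hroots, Multiset.map_const', Multiset.prod_replicate,
      ← hsplits.natDegree_eq_card_roots, natDegree_map, pow_mul]
  have hzpow : w ^ (k * n) = w ^ ((m * g.natDegree : ℕ) : ℤ) := by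
    rw [zpow_mul, zpow_natCast, zpow_natCast, ← hprod, ← hk, ← coeff_map, hcoeff]
    simp
  have hndvd : n ∣ g.natDegree := by
    refine hnm.dvd_of_dvd_mul_left (Int.natCast_dvd_natCast.1 ⟨k, ?_⟩)
    rw [← zpow_right_injective₀ hwpos hϖ.ne hzpow, mul_comm]
  have hdeg : ((X : K[X]) ^ n - C (ϖ ^ m)).natDegree ≤ g.natDegree := by
    rw [natDegree_X_pow_sub_C]
    exact Nat.le_of_dvd (minpoly.natDegree_pos hint) hndvd
  rw [eq_of_monic_of_dvd_of_natDegree_le hgm hmonic hdvd hdeg]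
  exact minpoly.irreducible hint

end AbsoluteValue

theorem exists_absoluteValue_extending_padic (p : ℕ) [Fact p.Prime] (L : Type*) [Field L]
    [Algebra ℚ_[p] L] [Algebra.IsAlgebraic ℚ_[p] L] :
    ∃ v : AbsoluteValue L ℝ, IsNonarchimedean v ∧ ∀ a : ℚ_[p], v (algebraMap ℚ_[p] L a) = ‖a‖ :=
  ⟨{ toFun := spectralNorm ℚ_[p] L
     map_mul' := map_mul (spectralMulAlgNorm ℚ_[p] L)
     nonneg' := apply_nonneg (spectralMulAlgNorm ℚ_[p] L)
     eq_zero' := fun _ => map_eq_zero_iff_eq_zero (spectralMulAlgNorm ℚ_[p] L)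
     add_le' := map_add_le_add (spectralMulAlgNorm ℚ_[p] L) },
    isNonarchimedean_spectralNorm, spectralNorm_extends⟩

theorem Nat.coprime_pow_sub_one_half_pow_add_one_half {p a b : ℕ} (hp : Odd p) (hp1 : 1 < p)
    (ha : Odd a) (hab : a.Coprime b) : ((p ^ a - 1) / 2).Coprime ((p ^ b + 1) / 2) := by
  have hA : 2 ∣ p ^ a - 1 := by
    have := hp.pow (n := a)
    exact (Nat.Odd.sub_odd this odd_one).two_dvd
  have hB : 2 ∣ p ^ b + 1 := (hp.pow.add_odd odd_one).two_dvd
  set d := ((p ^ a - 1) / 2).gcd ((p ^ b + 1) / 2)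
  have hdA : 2 * d ∣ p ^ a - 1 := by
    simpa [Nat.mul_div_cancel' hA] using mul_dvd_mul_left 2 (Nat.gcd_dvd_left ((p ^ a - 1) / 2) _)
  have hdB : 2 * d ∣ p ^ b + 1 := by
    simpa [Nat.mul_div_cancel' hB] using mul_dvd_mul_left 2 (Nat.gcd_dvd_right _ ((p ^ b + 1) / 2))
  have hdB' : 2 * d ∣ p ^ (2 * b) - 1 := by
    rw [mul_comm 2 b, pow_mul]
    simpa using hdB.trans (Dvd.intro _ (Nat.sq_sub_sq (p ^ b) 1).symm)
  have hgcd : a.gcd (2 * b) = 1 := Nat.Coprime.mul_right ha.coprime_two_right hab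
  have hd1 : 2 * d ∣ p - 1 := by
    simpa [Nat.pow_sub_one_gcd_pow_sub_one, hgcd] using Nat.dvd_gcd hdA hdB'
  have hb : 2 * d ∣ p ^ b - 1 := hd1.trans (by simpa using Nat.sub_dvd_pow_sub_pow p 1 b)
  have h2 : 2 * d ∣ 2 := by
    have hpos : 1 ≤ p ^ b := Nat.one_le_pow _ _ (by omega)
    have := Nat.dvd_sub hdB hb
    rwa [show p ^ b + 1 - (p ^ b - 1) = 2 by omega] at this
  have := Nat.le_of_dvd two_pos h2
  have hdpos : d ≠ 0 := by
    intro h0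
    simp [h0] at h2
  show d = 1
  omega

/-- Assume `h = h₁ + h₂` is odd (`p` an odd prime, `h₁, h₂ ≥ 2` coprime).
Then for each `i ∈ {1,2}`, the polynomial `T^{(p^h − 1)/2} − p^{(p^{h_i} + 1)/2}` is irreducible
over the unramified extension `U_h = ℚ_p(ζ)` of degree `h` of `ℚ_p`. -/
theorem uniformizer_polynomial_irreducible (p : ℕ) [Fact p.Prime] (hodd : Odd p) (h₁ h₂ : ℕ)
    (hh₁ : 2 ≤ h₁) (hh₂ : 2 ≤ h₂) (hcop : Nat.Coprime h₁ h₂) (hhodd : Odd (h₁ + h₂))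
    (Ω : Type) [Field Ω] [Algebra ℚ_[p] Ω] [IsAlgClosure ℚ_[p] Ω]
    (ζ : Ω) (hζ : IsPrimitiveRoot ζ (p ^ (h₁ + h₂) - 1))
    (Uh : IntermediateField ℚ_[p] Ω) (hUh : Uh = IntermediateField.adjoin ℚ_[p] {ζ}) :
    Irreducible ((Polynomial.X : Polynomial ↥Uh) ^ ((p ^ (h₁ + h₂) - 1) / 2)
        - Polynomial.C ((p : ↥Uh) ^ ((p ^ h₁ + 1) / 2)))
    ∧ Irreducible ((Polynomial.X : Polynomial ↥Uh) ^ ((p ^ (h₁ + h₂) - 1) / 2)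
        - Polynomial.C ((p : ↥Uh) ^ ((p ^ h₂ + 1) / 2))) := by
  have hp1 : 1 < p := (Fact.out : p.Prime).one_lt
  have hh : h₁ + h₂ ≠ 0 := by omega
  have : Algebra.IsAlgebraic ℚ_[p] Ω := IsAlgClosure.isAlgebraic
  have : IsAlgClosed Ω := IsAlgClosure.isAlgClosed ℚ_[p]
  obtain ⟨v, hv, hext⟩ := exists_absoluteValue_extending_padic p Ω
  have hζpow : ζ ^ p ^ (h₁ + h₂) = ζ := by
    rw [← Nat.sub_add_cancel (Nat.one_le_pow (h₁ + h₂) p (by omega)), pow_succ, hζ.pow_eq_one,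
      one_mul]
  have hvp : v (p : Ω) < 1 := by
    rw [← map_natCast (algebraMap ℚ_[p] Ω), hext, Padic.norm_p]
    exact inv_lt_one_of_one_lt₀ (mod_cast hp1)
  have : CharZero Uh := charZero_of_injective_algebraMap (algebraMap ℚ_[p] Uh).injective
  have hp0 : (p : Uh) ≠ 0 := by exact_mod_cast (Fact.out : p.Prime).ne_zero
  have hval (c : Uh) (hc : c ≠ 0) :
      ∃ k : ℤ, v (algebraMap Uh Ω c) = v (algebraMap Uh Ω p) ^ k := by
    rw [map_natCast]
    exact v.exists_eq_zpow_of_mem_adjoin_padic hv hext hh (Algebra.IsAlgebraic.isAlgebraic ζ)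
      hζpow (hUh ▸ c.2) (by simpa using hc)
  have hn : (p ^ (h₁ + h₂) - 1) / 2 ≠ 0 := by
    have : 2 < p := by
      obtain ⟨k, rfl⟩ := hodd
      omega
    have := Nat.le_self_pow hh p
    omega
  have hirr (b : ℕ) (hb : (h₁ + h₂).Coprime b) :=
    v.irreducible_X_pow_sub_C_pow hp0 (by rwa [map_natCast]) hval hn
      (Nat.coprime_pow_sub_one_half_pow_add_one_half hodd hp1 hhodd hb)
  exact ⟨hirr h₁ (by simpa using hcop.symm), hirr h₂ (by simpa using hcop)⟩
end
end
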